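/- arXiv:2305.19525 — 5 statements merged into one kernel-verified Lean document; each statement's English description precedes it below -/
import Mathlib

section
/- Consider the 2D ideal-fluid element system, and define D(t) = u₁(y₂−y₃) + v₁(x₃−x₂) + u₂(y₃−y₁) + v₂(x₁−x₃) + u₃(y₁−y₂) + v₃(x₂−x₁) (all functions evaluated at t). Then D is constant in t; equivalently, the second time derivative of the triangle area A = x₁y₂ + x₂y₃ + x₃y₁ − x₂y₁ − x₃y₂ − x₁y₃ vanishes identically along the trajectory. -/
/-- In the 2D ideal-fluid element system, the divergence D (the time derivative of the triangle area) is conserved, i.e. the second time derivative of the area vanishes. -/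
theorem fluid2d_divergence_conserved
    (x₁ y₁ u₁ v₁ x₂ y₂ u₂ v₂ x₃ y₃ u₃ v₃ lam : ℝ → ℝ)
    (hQ : ∀ t : ℝ,
      -x₁ t ^ 2 + x₁ t * x₂ t + x₁ t * x₃ t - x₂ t ^ 2 + x₂ t * x₃ t - x₃ t ^ 2
        - y₁ t ^ 2 + y₁ t * y₂ t + y₁ t * y₃ t - y₂ t ^ 2 + y₂ t * y₃ t - y₃ t ^ 2 ≠ 0)
    (hlam : ∀ t : ℝ, lam t =
      (u₁ t * v₂ t - u₁ t * v₃ t - u₂ t * v₁ t + u₂ t * v₃ t + u₃ t * v₁ t - u₃ t * v₂ t) /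
      (-x₁ t ^ 2 + x₁ t * x₂ t + x₁ t * x₃ t - x₂ t ^ 2 + x₂ t * x₃ t - x₃ t ^ 2
        - y₁ t ^ 2 + y₁ t * y₂ t + y₁ t * y₃ t - y₂ t ^ 2 + y₂ t * y₃ t - y₃ t ^ 2))
    (hx₁ : ∀ t, HasDerivAt x₁ (u₁ t) t) (hy₁ : ∀ t, HasDerivAt y₁ (v₁ t) t)
    (hx₂ : ∀ t, HasDerivAt x₂ (u₂ t) t) (hy₂ : ∀ t, HasDerivAt y₂ (v₂ t) t)
    (hx₃ : ∀ t, HasDerivAt x₃ (u₃ t) t) (hy₃ : ∀ t, HasDerivAt y₃ (v₃ t) t)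
    (hu₁ : ∀ t, HasDerivAt u₁ (lam t * (y₂ t - y₃ t)) t)
    (hv₁ : ∀ t, HasDerivAt v₁ (lam t * (x₃ t - x₂ t)) t)
    (hu₂ : ∀ t, HasDerivAt u₂ (lam t * (y₃ t - y₁ t)) t)
    (hv₂ : ∀ t, HasDerivAt v₂ (lam t * (x₁ t - x₃ t)) t)
    (hu₃ : ∀ t, HasDerivAt u₃ (lam t * (y₁ t - y₂ t)) t)
    (hv₃ : ∀ t, HasDerivAt v₃ (lam t * (x₂ t - x₁ t)) t) :
    ∀ s t : ℝ,
      u₁ s * (y₂ s - y₃ s) + v₁ s * (x₃ s - x₂ s) + u₂ s * (y₃ s - y₁ s)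
        + v₂ s * (x₁ s - x₃ s) + u₃ s * (y₁ s - y₂ s) + v₃ s * (x₂ s - x₁ s)
      = u₁ t * (y₂ t - y₃ t) + v₁ t * (x₃ t - x₂ t) + u₂ t * (y₃ t - y₁ t)
        + v₂ t * (x₁ t - x₃ t) + u₃ t * (y₁ t - y₂ t) + v₃ t * (x₂ t - x₁ t) := by
  have hN : ∀ t, lam t *
      (-x₁ t ^ 2 + x₁ t * x₂ t + x₁ t * x₃ t - x₂ t ^ 2 + x₂ t * x₃ t - x₃ t ^ 2
        - y₁ t ^ 2 + y₁ t * y₂ t + y₁ t * y₃ t - y₂ t ^ 2 + y₂ t * y₃ t - y₃ t ^ 2) =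
      u₁ t * v₂ t - u₁ t * v₃ t - u₂ t * v₁ t + u₂ t * v₃ t + u₃ t * v₁ t - u₃ t * v₂ t :=
    fun t ↦ (eq_div_iff (hQ t)).mp (hlam t)
  have hD : ∀ t, HasDerivAt (fun t ↦
      u₁ t * (y₂ t - y₃ t) + v₁ t * (x₃ t - x₂ t) + u₂ t * (y₃ t - y₁ t)
        + v₂ t * (x₁ t - x₃ t) + u₃ t * (y₁ t - y₂ t) + v₃ t * (x₂ t - x₁ t)) 0 t := by
    intro t
    refine HasDerivAt.congr_deriv
      (((((((hu₁ t).fun_mul ((hy₂ t).fun_sub (hy₃ t))).fun_add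
        ((hv₁ t).fun_mul ((hx₃ t).fun_sub (hx₂ t)))).fun_add
        ((hu₂ t).fun_mul ((hy₃ t).fun_sub (hy₁ t)))).fun_add
        ((hv₂ t).fun_mul ((hx₁ t).fun_sub (hx₃ t)))).fun_add
        ((hu₃ t).fun_mul ((hy₁ t).fun_sub (hy₂ t)))).fun_add
        ((hv₃ t).fun_mul ((hx₂ t).fun_sub (hx₁ t)))) ?_
    linear_combination (-2) * hN t
  exact is_const_of_deriv_eq_zero (fun t ↦ (hD t).differentiableAt) (fun t ↦ (hD t).deriv)
end

section
/- Consider the 2D ideal-fluid element system, and suppose that at time t = 0 the divergence D = u₁(y₂−y₃) + v₁(x₃−x₂) + u₂(y₃−y₁) + v₂(x₁−x₃) + u₃(y₁−y₂) + v₃(x₂−x₁) vanishes. Then the triangle area A(t) = x₁y₂ + x₂y₃ + x₃y₁ − x₂y₁ − x₃y₂ − x₁y₃ (all functions evaluated at t) is constant in t. -/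
/-- In the 2D ideal-fluid element system, if the divergence vanishes at time 0, then the triangle area is conserved. -/
theorem fluid2d_area_conserved
    (x₁ y₁ u₁ v₁ x₂ y₂ u₂ v₂ x₃ y₃ u₃ v₃ lam : ℝ → ℝ)
    (hQ : ∀ t : ℝ,
      -x₁ t ^ 2 + x₁ t * x₂ t + x₁ t * x₃ t - x₂ t ^ 2 + x₂ t * x₃ t - x₃ t ^ 2
        - y₁ t ^ 2 + y₁ t * y₂ t + y₁ t * y₃ t - y₂ t ^ 2 + y₂ t * y₃ t - y₃ t ^ 2 ≠ 0)
    (hlam : ∀ t : ℝ, lam t =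
      (u₁ t * v₂ t - u₁ t * v₃ t - u₂ t * v₁ t + u₂ t * v₃ t + u₃ t * v₁ t - u₃ t * v₂ t) /
      (-x₁ t ^ 2 + x₁ t * x₂ t + x₁ t * x₃ t - x₂ t ^ 2 + x₂ t * x₃ t - x₃ t ^ 2
        - y₁ t ^ 2 + y₁ t * y₂ t + y₁ t * y₃ t - y₂ t ^ 2 + y₂ t * y₃ t - y₃ t ^ 2))
    (hx₁ : ∀ t, HasDerivAt x₁ (u₁ t) t) (hy₁ : ∀ t, HasDerivAt y₁ (v₁ t) t)
    (hx₂ : ∀ t, HasDerivAt x₂ (u₂ t) t) (hy₂ : ∀ t, HasDerivAt y₂ (v₂ t) t)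
    (hx₃ : ∀ t, HasDerivAt x₃ (u₃ t) t) (hy₃ : ∀ t, HasDerivAt y₃ (v₃ t) t)
    (hu₁ : ∀ t, HasDerivAt u₁ (lam t * (y₂ t - y₃ t)) t)
    (hv₁ : ∀ t, HasDerivAt v₁ (lam t * (x₃ t - x₂ t)) t)
    (hu₂ : ∀ t, HasDerivAt u₂ (lam t * (y₃ t - y₁ t)) t)
    (hv₂ : ∀ t, HasDerivAt v₂ (lam t * (x₁ t - x₃ t)) t)
    (hu₃ : ∀ t, HasDerivAt u₃ (lam t * (y₁ t - y₂ t)) t)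
    (hv₃ : ∀ t, HasDerivAt v₃ (lam t * (x₂ t - x₁ t)) t)
    (hD0 : u₁ 0 * (y₂ 0 - y₃ 0) + v₁ 0 * (x₃ 0 - x₂ 0) + u₂ 0 * (y₃ 0 - y₁ 0)
        + v₂ 0 * (x₁ 0 - x₃ 0) + u₃ 0 * (y₁ 0 - y₂ 0) + v₃ 0 * (x₂ 0 - x₁ 0) = 0) :
    ∀ s t : ℝ,
      x₁ s * y₂ s + x₂ s * y₃ s + x₃ s * y₁ s - x₂ s * y₁ s - x₃ s * y₂ s - x₁ s * y₃ s
      = x₁ t * y₂ t + x₂ t * y₃ t + x₃ t * y₁ t - x₂ t * y₁ t - x₃ t * y₂ t - x₁ t * y₃ t := by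
  set D : ℝ → ℝ := fun t ↦ u₁ t * (y₂ t - y₃ t) + v₁ t * (x₃ t - x₂ t) + u₂ t * (y₃ t - y₁ t)
        + v₂ t * (x₁ t - x₃ t) + u₃ t * (y₁ t - y₂ t) + v₃ t * (x₂ t - x₁ t) with hDdef
  have hD' : ∀ t, HasDerivAt D 0 t := fun t ↦ by
    have h := ((((((hu₁ t).fun_mul ((hy₂ t).fun_sub (hy₃ t))).fun_add
      ((hv₁ t).fun_mul ((hx₃ t).fun_sub (hx₂ t)))).fun_add
      ((hu₂ t).fun_mul ((hy₃ t).fun_sub (hy₁ t)))).fun_add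
      ((hv₂ t).fun_mul ((hx₁ t).fun_sub (hx₃ t)))).fun_add
      ((hu₃ t).fun_mul ((hy₁ t).fun_sub (hy₂ t)))).fun_add
      ((hv₃ t).fun_mul ((hx₂ t).fun_sub (hx₁ t)))
    have hN := (eq_div_iff (hQ t)).mp (hlam t)
    exact h.congr_deriv (by linear_combination -2 * hN)
  have hD : ∀ t, D t = 0 := fun t ↦
    (is_const_of_deriv_eq_zero (fun r ↦ (hD' r).differentiableAt) (fun r ↦ (hD' r).deriv)
      t 0).trans hD0
  have hA : ∀ t, HasDerivAt (fun t ↦ x₁ t * y₂ t + x₂ t * y₃ t + x₃ t * y₁ t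
      - x₂ t * y₁ t - x₃ t * y₂ t - x₁ t * y₃ t) 0 t := fun t ↦ by
    have h := ((((((hx₁ t).fun_mul (hy₂ t)).fun_add ((hx₂ t).fun_mul (hy₃ t))).fun_add
      ((hx₃ t).fun_mul (hy₁ t))).fun_sub ((hx₂ t).fun_mul (hy₁ t))).fun_sub
      ((hx₃ t).fun_mul (hy₂ t))).fun_sub ((hx₁ t).fun_mul (hy₃ t))
    have hDt := hD t
    simp only [hDdef] at hDt
    exact h.congr_deriv (by linear_combination hDt)
  exact is_const_of_deriv_eq_zero (fun r ↦ (hA r).differentiableAt) (fun r ↦ (hA r).deriv)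
end

section
/- Consider the 2D ideal-fluid element system, and suppose that at time t = 0 the divergence D = u₁(y₂−y₃) + v₁(x₃−x₂) + u₂(y₃−y₁) + v₂(x₁−x₃) + u₃(y₁−y₂) + v₃(x₂−x₁) vanishes. Then the total kinetic energy (1/2)(u₁² + v₁² + u₂² + v₂² + u₃² + v₃²) (all functions evaluated at t) is constant in t. -/
/-- In the 2D ideal-fluid element system, if the divergence vanishes at time 0, then the total kinetic energy is conserved. -/
theorem fluid2d_energy_conserved
    (x₁ y₁ u₁ v₁ x₂ y₂ u₂ v₂ x₃ y₃ u₃ v₃ lam : ℝ → ℝ)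
    (hQ : ∀ t : ℝ,
      -x₁ t ^ 2 + x₁ t * x₂ t + x₁ t * x₃ t - x₂ t ^ 2 + x₂ t * x₃ t - x₃ t ^ 2
        - y₁ t ^ 2 + y₁ t * y₂ t + y₁ t * y₃ t - y₂ t ^ 2 + y₂ t * y₃ t - y₃ t ^ 2 ≠ 0)
    (hlam : ∀ t : ℝ, lam t =
      (u₁ t * v₂ t - u₁ t * v₃ t - u₂ t * v₁ t + u₂ t * v₃ t + u₃ t * v₁ t - u₃ t * v₂ t) /
      (-x₁ t ^ 2 + x₁ t * x₂ t + x₁ t * x₃ t - x₂ t ^ 2 + x₂ t * x₃ t - x₃ t ^ 2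
        - y₁ t ^ 2 + y₁ t * y₂ t + y₁ t * y₃ t - y₂ t ^ 2 + y₂ t * y₃ t - y₃ t ^ 2))
    (hx₁ : ∀ t, HasDerivAt x₁ (u₁ t) t) (hy₁ : ∀ t, HasDerivAt y₁ (v₁ t) t)
    (hx₂ : ∀ t, HasDerivAt x₂ (u₂ t) t) (hy₂ : ∀ t, HasDerivAt y₂ (v₂ t) t)
    (hx₃ : ∀ t, HasDerivAt x₃ (u₃ t) t) (hy₃ : ∀ t, HasDerivAt y₃ (v₃ t) t)
    (hu₁ : ∀ t, HasDerivAt u₁ (lam t * (y₂ t - y₃ t)) t)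
    (hv₁ : ∀ t, HasDerivAt v₁ (lam t * (x₃ t - x₂ t)) t)
    (hu₂ : ∀ t, HasDerivAt u₂ (lam t * (y₃ t - y₁ t)) t)
    (hv₂ : ∀ t, HasDerivAt v₂ (lam t * (x₁ t - x₃ t)) t)
    (hu₃ : ∀ t, HasDerivAt u₃ (lam t * (y₁ t - y₂ t)) t)
    (hv₃ : ∀ t, HasDerivAt v₃ (lam t * (x₂ t - x₁ t)) t)
    (hD0 : u₁ 0 * (y₂ 0 - y₃ 0) + v₁ 0 * (x₃ 0 - x₂ 0) + u₂ 0 * (y₃ 0 - y₁ 0)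
        + v₂ 0 * (x₁ 0 - x₃ 0) + u₃ 0 * (y₁ 0 - y₂ 0) + v₃ 0 * (x₂ 0 - x₁ 0) = 0) :
    ∀ s t : ℝ,
      (1 / 2) * (u₁ s ^ 2 + v₁ s ^ 2 + u₂ s ^ 2 + v₂ s ^ 2 + u₃ s ^ 2 + v₃ s ^ 2)
      = (1 / 2) * (u₁ t ^ 2 + v₁ t ^ 2 + u₂ t ^ 2 + v₂ t ^ 2 + u₃ t ^ 2 + v₃ t ^ 2) := by
  have const_of_hasDerivAt_zero : ∀ f : ℝ → ℝ, (∀ t, HasDerivAt f 0 t) → ∀ s t, f s = f t :=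
    fun f hf => is_const_of_deriv_eq_zero (fun t => (hf t).differentiableAt) fun t => (hf t).deriv
  have hD : ∀ t, u₁ t * (y₂ t - y₃ t) + v₁ t * (x₃ t - x₂ t) + u₂ t * (y₃ t - y₁ t)
      + v₂ t * (x₁ t - x₃ t) + u₃ t * (y₁ t - y₂ t) + v₃ t * (x₂ t - x₁ t) = 0 := by
    intro t
    rw [← hD0]
    refine const_of_hasDerivAt_zero (fun t => u₁ t * (y₂ t - y₃ t) + v₁ t * (x₃ t - x₂ t)
      + u₂ t * (y₃ t - y₁ t) + v₂ t * (x₁ t - x₃ t) + u₃ t * (y₁ t - y₂ t)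
      + v₃ t * (x₂ t - x₁ t)) (fun r => ?_) t 0
    have hlamQ := (eq_div_iff (hQ r)).mp (hlam r)
    refine (((((((hu₁ r).mul ((hy₂ r).sub (hy₃ r))).add ((hv₁ r).mul ((hx₃ r).sub (hx₂ r)))).add
      ((hu₂ r).mul ((hy₃ r).sub (hy₁ r)))).add ((hv₂ r).mul ((hx₁ r).sub (hx₃ r)))).add
      ((hu₃ r).mul ((hy₁ r).sub (hy₂ r)))).add
      ((hv₃ r).mul ((hx₂ r).sub (hx₁ r)))).congr_deriv ?_
    simp only [Pi.sub_apply]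
    linear_combination (-2) * hlamQ
  refine const_of_hasDerivAt_zero (fun t => (1 / 2) * (u₁ t ^ 2 + v₁ t ^ 2 + u₂ t ^ 2 + v₂ t ^ 2
    + u₃ t ^ 2 + v₃ t ^ 2)) fun r => ?_
  refine ((((((((hu₁ r).pow 2).add ((hv₁ r).pow 2)).add ((hu₂ r).pow 2)).add ((hv₂ r).pow 2)).add
    ((hu₃ r).pow 2)).add ((hv₃ r).pow 2)).const_mul (1 / 2)).congr_deriv ?_
  push_cast
  linear_combination lam r * hD r
end

section
/- Consider the 2D ideal-fluid element system. Define x_cm = (x₁+x₂+x₃)/3, y_cm = (y₁+y₂+y₃)/3, u_cm = (u₁+u₂+u₃)/3, v_cm = (v₁+v₂+v₃)/3, and barred quantities x̄ᵢ = xᵢ − x_cm, ȳᵢ = yᵢ − y_cm, ūᵢ = uᵢ − u_cm, v̄ᵢ = vᵢ − v_cm for i = 1,2,3. Then the angular momentum about the center of mass, L(t) = v̄₁x̄₁ + v̄₂x̄₂ + v̄₃x̄₃ − ū₁ȳ₁ − ū₂ȳ₂ − ū₃ȳ₃ (evaluated at t), is constant in t. -/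
/-- In the 2D ideal-fluid element system, the angular momentum about the center of mass is conserved. -/
theorem fluid2d_angular_momentum_conserved
    (x₁ y₁ u₁ v₁ x₂ y₂ u₂ v₂ x₃ y₃ u₃ v₃ lam : ℝ → ℝ)
    (hQ : ∀ t : ℝ,
      -x₁ t ^ 2 + x₁ t * x₂ t + x₁ t * x₃ t - x₂ t ^ 2 + x₂ t * x₃ t - x₃ t ^ 2
        - y₁ t ^ 2 + y₁ t * y₂ t + y₁ t * y₃ t - y₂ t ^ 2 + y₂ t * y₃ t - y₃ t ^ 2 ≠ 0)
    (hlam : ∀ t : ℝ, lam t =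
      (u₁ t * v₂ t - u₁ t * v₃ t - u₂ t * v₁ t + u₂ t * v₃ t + u₃ t * v₁ t - u₃ t * v₂ t) /
      (-x₁ t ^ 2 + x₁ t * x₂ t + x₁ t * x₃ t - x₂ t ^ 2 + x₂ t * x₃ t - x₃ t ^ 2
        - y₁ t ^ 2 + y₁ t * y₂ t + y₁ t * y₃ t - y₂ t ^ 2 + y₂ t * y₃ t - y₃ t ^ 2))
    (hx₁ : ∀ t, HasDerivAt x₁ (u₁ t) t) (hy₁ : ∀ t, HasDerivAt y₁ (v₁ t) t)
    (hx₂ : ∀ t, HasDerivAt x₂ (u₂ t) t) (hy₂ : ∀ t, HasDerivAt y₂ (v₂ t) t)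
    (hx₃ : ∀ t, HasDerivAt x₃ (u₃ t) t) (hy₃ : ∀ t, HasDerivAt y₃ (v₃ t) t)
    (hu₁ : ∀ t, HasDerivAt u₁ (lam t * (y₂ t - y₃ t)) t)
    (hv₁ : ∀ t, HasDerivAt v₁ (lam t * (x₃ t - x₂ t)) t)
    (hu₂ : ∀ t, HasDerivAt u₂ (lam t * (y₃ t - y₁ t)) t)
    (hv₂ : ∀ t, HasDerivAt v₂ (lam t * (x₁ t - x₃ t)) t)
    (hu₃ : ∀ t, HasDerivAt u₃ (lam t * (y₁ t - y₂ t)) t)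
    (hv₃ : ∀ t, HasDerivAt v₃ (lam t * (x₂ t - x₁ t)) t) :
    ∀ s t : ℝ,
      (v₁ s - (v₁ s + v₂ s + v₃ s) / 3) * (x₁ s - (x₁ s + x₂ s + x₃ s) / 3)
        + (v₂ s - (v₁ s + v₂ s + v₃ s) / 3) * (x₂ s - (x₁ s + x₂ s + x₃ s) / 3)
        + (v₃ s - (v₁ s + v₂ s + v₃ s) / 3) * (x₃ s - (x₁ s + x₂ s + x₃ s) / 3)
        - (u₁ s - (u₁ s + u₂ s + u₃ s) / 3) * (y₁ s - (y₁ s + y₂ s + y₃ s) / 3)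
        - (u₂ s - (u₁ s + u₂ s + u₃ s) / 3) * (y₂ s - (y₁ s + y₂ s + y₃ s) / 3)
        - (u₃ s - (u₁ s + u₂ s + u₃ s) / 3) * (y₃ s - (y₁ s + y₂ s + y₃ s) / 3)
      = (v₁ t - (v₁ t + v₂ t + v₃ t) / 3) * (x₁ t - (x₁ t + x₂ t + x₃ t) / 3)
        + (v₂ t - (v₁ t + v₂ t + v₃ t) / 3) * (x₂ t - (x₁ t + x₂ t + x₃ t) / 3)
        + (v₃ t - (v₁ t + v₂ t + v₃ t) / 3) * (x₃ t - (x₁ t + x₂ t + x₃ t) / 3)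
        - (u₁ t - (u₁ t + u₂ t + u₃ t) / 3) * (y₁ t - (y₁ t + y₂ t + y₃ t) / 3)
        - (u₂ t - (u₁ t + u₂ t + u₃ t) / 3) * (y₂ t - (y₁ t + y₂ t + y₃ t) / 3)
        - (u₃ t - (u₁ t + u₂ t + u₃ t) / 3) * (y₃ t - (y₁ t + y₂ t + y₃ t) / 3) := by
  have hL : ∀ t, HasDerivAt
      (fun t =>
        (v₁ t - (v₁ t + v₂ t + v₃ t) / 3) * (x₁ t - (x₁ t + x₂ t + x₃ t) / 3)
        + (v₂ t - (v₁ t + v₂ t + v₃ t) / 3) * (x₂ t - (x₁ t + x₂ t + x₃ t) / 3)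
        + (v₃ t - (v₁ t + v₂ t + v₃ t) / 3) * (x₃ t - (x₁ t + x₂ t + x₃ t) / 3)
        - (u₁ t - (u₁ t + u₂ t + u₃ t) / 3) * (y₁ t - (y₁ t + y₂ t + y₃ t) / 3)
        - (u₂ t - (u₁ t + u₂ t + u₃ t) / 3) * (y₂ t - (y₁ t + y₂ t + y₃ t) / 3)
        - (u₃ t - (u₁ t + u₂ t + u₃ t) / 3) * (y₃ t - (y₁ t + y₂ t + y₃ t) / 3)) 0 t := by
    intro t
    have hx := (((hx₁ t).fun_add (hx₂ t)).fun_add (hx₃ t)).div_const 3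
    have hy := (((hy₁ t).fun_add (hy₂ t)).fun_add (hy₃ t)).div_const 3
    have hu := (((hu₁ t).fun_add (hu₂ t)).fun_add (hu₃ t)).div_const 3
    have hv := (((hv₁ t).fun_add (hv₂ t)).fun_add (hv₃ t)).div_const 3
    refine (((((
      (((hv₁ t).fun_sub hv).fun_mul ((hx₁ t).fun_sub hx)).fun_add
      (((hv₂ t).fun_sub hv).fun_mul ((hx₂ t).fun_sub hx))).fun_add
      (((hv₃ t).fun_sub hv).fun_mul ((hx₃ t).fun_sub hx))).fun_sub
      (((hu₁ t).fun_sub hu).fun_mul ((hy₁ t).fun_sub hy))).fun_sub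
      (((hu₂ t).fun_sub hu).fun_mul ((hy₂ t).fun_sub hy))).fun_sub
      (((hu₃ t).fun_sub hu).fun_mul ((hy₃ t).fun_sub hy))).congr_deriv ?_
    ring
  exact is_const_of_deriv_eq_zero (fun t => (hL t).differentiableAt) (fun t => (hL t).deriv)
end

section
/- Consider the 2D ideal-fluid element system. Then the vorticity ω(t) = u₁(x₂−x₃) + u₂(x₃−x₁) + u₃(x₁−x₂) + v₁(y₂−y₃) + v₂(y₃−y₁) + v₃(y₁−y₂) (all functions evaluated at t) is constant in t. -/
/-- In the 2D ideal-fluid element system, the vorticity ω is conserved. -/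
theorem fluid2d_vorticity_conserved
    (x₁ y₁ u₁ v₁ x₂ y₂ u₂ v₂ x₃ y₃ u₃ v₃ lam : ℝ → ℝ)
    (hQ : ∀ t : ℝ,
      -x₁ t ^ 2 + x₁ t * x₂ t + x₁ t * x₃ t - x₂ t ^ 2 + x₂ t * x₃ t - x₃ t ^ 2
        - y₁ t ^ 2 + y₁ t * y₂ t + y₁ t * y₃ t - y₂ t ^ 2 + y₂ t * y₃ t - y₃ t ^ 2 ≠ 0)
    (hlam : ∀ t : ℝ, lam t =
      (u₁ t * v₂ t - u₁ t * v₃ t - u₂ t * v₁ t + u₂ t * v₃ t + u₃ t * v₁ t - u₃ t * v₂ t) /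
      (-x₁ t ^ 2 + x₁ t * x₂ t + x₁ t * x₃ t - x₂ t ^ 2 + x₂ t * x₃ t - x₃ t ^ 2
        - y₁ t ^ 2 + y₁ t * y₂ t + y₁ t * y₃ t - y₂ t ^ 2 + y₂ t * y₃ t - y₃ t ^ 2))
    (hx₁ : ∀ t, HasDerivAt x₁ (u₁ t) t) (hy₁ : ∀ t, HasDerivAt y₁ (v₁ t) t)
    (hx₂ : ∀ t, HasDerivAt x₂ (u₂ t) t) (hy₂ : ∀ t, HasDerivAt y₂ (v₂ t) t)
    (hx₃ : ∀ t, HasDerivAt x₃ (u₃ t) t) (hy₃ : ∀ t, HasDerivAt y₃ (v₃ t) t)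
    (hu₁ : ∀ t, HasDerivAt u₁ (lam t * (y₂ t - y₃ t)) t)
    (hv₁ : ∀ t, HasDerivAt v₁ (lam t * (x₃ t - x₂ t)) t)
    (hu₂ : ∀ t, HasDerivAt u₂ (lam t * (y₃ t - y₁ t)) t)
    (hv₂ : ∀ t, HasDerivAt v₂ (lam t * (x₁ t - x₃ t)) t)
    (hu₃ : ∀ t, HasDerivAt u₃ (lam t * (y₁ t - y₂ t)) t)
    (hv₃ : ∀ t, HasDerivAt v₃ (lam t * (x₂ t - x₁ t)) t) :
    ∀ s t : ℝ,
      u₁ s * (x₂ s - x₃ s) + u₂ s * (x₃ s - x₁ s) + u₃ s * (x₁ s - x₂ s)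
        + v₁ s * (y₂ s - y₃ s) + v₂ s * (y₃ s - y₁ s) + v₃ s * (y₁ s - y₂ s)
      = u₁ t * (x₂ t - x₃ t) + u₂ t * (x₃ t - x₁ t) + u₃ t * (x₁ t - x₂ t)
        + v₁ t * (y₂ t - y₃ t) + v₂ t * (y₃ t - y₁ t) + v₃ t * (y₁ t - y₂ t) := by
  have hderiv : ∀ t, HasDerivAt
      (fun t => u₁ t * (x₂ t - x₃ t) + u₂ t * (x₃ t - x₁ t) + u₃ t * (x₁ t - x₂ t)
        + v₁ t * (y₂ t - y₃ t) + v₂ t * (y₃ t - y₁ t) + v₃ t * (y₁ t - y₂ t)) 0 t := by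
    intro t
    refine (((((((hu₁ t).fun_mul ((hx₂ t).fun_sub (hx₃ t))).fun_add
      ((hu₂ t).fun_mul ((hx₃ t).fun_sub (hx₁ t)))).fun_add
      ((hu₃ t).fun_mul ((hx₁ t).fun_sub (hx₂ t)))).fun_add
      ((hv₁ t).fun_mul ((hy₂ t).fun_sub (hy₃ t)))).fun_add
      ((hv₂ t).fun_mul ((hy₃ t).fun_sub (hy₁ t)))).fun_add
      ((hv₃ t).fun_mul ((hy₁ t).fun_sub (hy₂ t)))).congr_deriv ?_
    ring
  exact is_const_of_deriv_eq_zero (fun t => (hderiv t).differentiableAt)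
    (fun t => (hderiv t).deriv)
end
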